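/- arXiv:1108.6090 — 4 statements merged into one kernel-verified Lean document; each statement's English description precedes it below -/
import Mathlib

section
/- Let p ≥ 1, let A and B be p×p real matrices (regarded as complex matrices), and let t ∈ ℂ be such that the matrix I + t·B is invertible. Then for every integer j with 0 ≤ j ≤ p, one has Σ_{k=0}^{p} t^k · (d^j/ds^j)|_{s=0} σ_k(B + s·A) = j! · t^j · det(I + t·B) · σ_j(A·(I + t·B)^{-1}), where (d^j/ds^j)|_{s=0} denotes the j-th derivative at s = 0 of the (polynomial) function s ↦ σ_k(B + s·A). -/
open Matrix Polynomial

/-- The elementary symmetric functions `σ_k(M)` of a `p × p` matrix `M`, defined as the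
coefficient of `t^k` in `det(I + t • M)`. -/
noncomputable def esymm {R : Type*} [CommRing R] {p : ℕ} (k : ℕ)
    (M : Matrix (Fin p) (Fin p) R) : R :=
  ((1 + (X : R[X]) • M.map Polynomial.C).det).coeff k

/-- A real matrix regarded as a complex matrix via the canonical inclusion `ℝ → ℂ`. -/
def toC {p : ℕ} (A : Matrix (Fin p) (Fin p) ℝ) : Matrix (Fin p) (Fin p) ℂ :=
  A.map Complex.ofReal

theorem esymm_map_aux {R S : Type*} [CommRing R] [CommRing S] (f : R →+* S) {p : ℕ} (k : ℕ)
    (M : Matrix (Fin p) (Fin p) R) : esymm k (M.map f) = f (esymm k M) := by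
  unfold esymm
  rw [← Polynomial.coeff_map, ← Polynomial.coe_mapRingHom, RingHom.map_det]
  congr 2
  ext1 a b
  by_cases h : a = b
  · subst h; simp
  · simp [h]

theorem esymm_sum_aux {R : Type*} [CommRing R] {p : ℕ} (t : R)
    (M : Matrix (Fin p) (Fin p) R) :
    ∑ k ∈ Finset.range (p + 1), t ^ k * esymm k M = (1 + t • M).det := by
  have hd : ((1 + (X : R[X]) • M.map Polynomial.C).det).natDegree < p + 1 := by
    have := Polynomial.natDegree_det_X_add_C_le M 1
    rw [Fintype.card_fin] at this
    rw [add_comm (1 : Matrix (Fin p) (Fin p) R[X])]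
    simpa [Nat.lt_succ_iff] using this
  have h1 : (1 + t • M).det = ((1 + (X : R[X]) • M.map Polynomial.C).det).eval t := by
    rw [← Polynomial.coe_evalRingHom, RingHom.map_det]
    congr 1
    ext1 a b
    by_cases h : a = b
    · subst h; simp; ring
    · simp [h]; ring
  rw [h1, Polynomial.eval_eq_sum_range' hd]
  exact Finset.sum_congr rfl fun k _ => mul_comm _ _

theorem iter_aux (P : ℂ[X]) (j : ℕ) :
    iteratedDeriv j (fun s : ℂ => P.eval s) = fun s => (derivative^[j] P).eval s := by
  induction j generalizing P with
  | zero => simp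
  | succ n ih =>
    rw [iteratedDeriv_succ', Function.iterate_succ_apply, ← ih]
    congr 1
    ext s
    exact P.deriv

theorem stmt0 {p : ℕ} (hp : 1 ≤ p) (A B : Matrix (Fin p) (Fin p) ℝ) (t : ℂ)
    (hinv : IsUnit (1 + t • toC B)) (j : ℕ) (hj : j ≤ p) :
    ∑ k ∈ Finset.range (p + 1),
        t ^ k * iteratedDeriv j (fun s : ℂ => esymm k (toC B + s • toC A)) 0
      = (Nat.factorial j : ℂ) * t ^ j * (1 + t • toC B).det *
          esymm j (toC A * (1 + t • toC B)⁻¹) := by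
  generalize toC A = A' at *
  generalize toC B = B' at *
  set Q : Matrix (Fin p) (Fin p) ℂ[X] := B'.map C + (X : ℂ[X]) • A'.map C with hQ
  have h1 : ∀ k, iteratedDeriv j (fun s : ℂ => esymm k (B' + s • A')) 0
      = (Nat.factorial j : ℂ) * (esymm k Q).coeff j := by
    intro k
    have : (fun s : ℂ => esymm k (B' + s • A')) = fun s => (esymm k Q).eval s := by
      ext s
      rw [← Polynomial.coe_evalRingHom, ← esymm_map_aux]
      congr 1
      ext a b
      simp [hQ]; ring
    rw [this, iter_aux]
    simp only
    rw [← Polynomial.coeff_zero_eq_eval_zero, Polynomial.coeff_iterate_derivative]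
    simp [Nat.descFactorial_self]
  have h2 : ∑ k ∈ Finset.range (p + 1), t ^ k * ((Nat.factorial j : ℂ) * (esymm k Q).coeff j)
      = (Nat.factorial j : ℂ) * ((1 + C t • Q).det).coeff j := by
    rw [← esymm_sum_aux, Polynomial.finsetSum_coeff, Finset.mul_sum]
    refine Finset.sum_congr rfl fun k _ => ?_
    rw [← C_pow, coeff_C_mul]; ring
  set N := 1 + t • B' with hN
  have hdet : IsUnit N.det := (Matrix.isUnit_iff_isUnit_det _).1 hinv
  have h3 : (1 + C t • Q) = (1 + (C t * X) • (A' * N⁻¹).map C) * N.map C := by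
    have e1 : (A' * N⁻¹).map C * N.map C = A'.map C := by
      rw [← Matrix.map_mul, Matrix.mul_assoc, Matrix.nonsing_inv_mul _ hdet, Matrix.mul_one]
    have e2 : N.map C = 1 + C t • B'.map C := by
      ext1 a b
      by_cases h : a = b
      · subst h; simp [hN]
      · simp [hN, h]
    rw [add_mul, smul_mul_assoc, e1, e2, hQ, one_mul, smul_add, smul_smul, add_assoc]
  have h4 : (N.map C).det = C N.det := (RingHom.map_det C N).symm
  simp only [h1]
  rw [h2, h3, Matrix.det_mul, h4, coeff_mul_C, ← esymm_sum_aux, Polynomial.finsetSum_coeff,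
    Finset.sum_eq_single j]
  · rw [esymm_map_aux, coeff_mul_C, mul_pow, ← C_pow, coeff_C_mul, coeff_X_pow]
    simp; ring
  · intro k _ hk
    rw [esymm_map_aux, coeff_mul_C, mul_pow, ← C_pow, coeff_C_mul, coeff_X_pow]
    simp [hk.symm]
  · intro h
    exact absurd (Finset.mem_range.2 (by omega)) h
end

section
/- Let p ≥ 1 and q ≥ 0 be integers, let θ ∈ ℝ, and set φ = (π/2)·q − θ. Let A and B be p×p real symmetric matrices, regarded as complex matrices. Then Im( e^{−iθ} · i^q · det(I + i·(s·A + B)) ) = 0 for all s ∈ ℝ if and only if both of the following hold: (1) Im( e^{iφ} · det(I + i·B) ) = 0, and (2) σ_j( A·(I + i·B)^{-1} ) = (−1)^j · σ_j( A·(I − i·B)^{-1} ) for every j = 1, …, p. (Here I + i·B and I − i·B are invertible since B is real symmetric.) -/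
open Matrix Polynomial

noncomputable def sgP {p : ℕ} (M : Matrix (Fin p) (Fin p) ℂ) : ℂ[X] :=
  (1 + (X : ℂ[X]) • M.map Polynomial.C).det

lemma sgP_eval {p : ℕ} (M : Matrix (Fin p) (Fin p) ℂ) (z : ℂ) :
    (sgP M).eval z = (1 + z • M).det := by
  unfold sgP
  rw [← Polynomial.coe_evalRingHom, RingHom.map_det]
  congr 1
  ext i j
  simp [Matrix.one_apply, apply_ite (Polynomial.eval z)]
  ring

lemma sgP_deg {p : ℕ} (M : Matrix (Fin p) (Fin p) ℂ) : (sgP M).natDegree ≤ p := by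
  have h := Polynomial.natDegree_det_X_add_C_le M 1
  have e : (1 : Matrix (Fin p) (Fin p) ℂ).map Polynomial.C = 1 := by
    ext i j; simp [Matrix.one_apply, apply_ite]
  rw [e, add_comm] at h
  simpa [sgP] using h

lemma sgP_det {p : ℕ} (A K : Matrix (Fin p) (Fin p) ℂ) (hK : IsUnit K.det) (z : ℂ) :
    (K + z • A).det = (sgP (A * K⁻¹)).eval z * K.det := by
  rw [sgP_eval, ← Matrix.det_mul, add_mul, one_mul, smul_mul_assoc, mul_assoc,
    Matrix.nonsing_inv_mul _ hK, mul_one]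

lemma conj_det {p : ℕ} (M : Matrix (Fin p) (Fin p) ℝ) :
    (starRingEnd ℂ) (1 + Complex.I • toC M).det = (1 - Complex.I • toC M).det := by
  rw [RingHom.map_det]
  congr 1
  ext i j
  by_cases h : i = j <;> simp [toC, Matrix.one_apply, h, sub_eq_add_neg]

open scoped ComplexOrder in
lemma unit_det {p : ℕ} (B : Matrix (Fin p) (Fin p) ℝ) (hB : B.IsSymm) :
    (1 + Complex.I • toC B).det ≠ 0 ∧ (1 - Complex.I • toC B).det ≠ 0 := by
  have hH : (toC B)ᴴ = toC B := by
    ext i j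
    simp [toC, hB.apply]
  have hpd : (1 + (toC B)ᴴ * toC B).PosDef :=
    Matrix.PosDef.one.add_posSemidef (Matrix.posSemidef_conjTranspose_mul_self _)
  have hd := hpd.det_pos.ne'
  have e : (1 + (toC B)ᴴ * toC B) = (1 + Complex.I • toC B) * (1 - Complex.I • toC B) := by
    rw [hH]
    simp [add_mul, mul_sub, smul_smul]
    abel
  rw [e, Matrix.det_mul] at hd
  exact mul_ne_zero_iff.mp hd

theorem stmt3 {p : ℕ} (hp : 1 ≤ p) (q : ℕ) (θ φ : ℝ)
    (hφ : φ = Real.pi / 2 * q - θ)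
    (A B : Matrix (Fin p) (Fin p) ℝ) (hA : A.IsSymm) (hB : B.IsSymm) :
    (∀ s : ℝ,
        (Complex.exp (-(Complex.I * (θ : ℂ))) * Complex.I ^ q *
          (1 + Complex.I • ((s : ℂ) • toC A + toC B)).det).im = 0)
      ↔ ((Complex.exp (Complex.I * (φ : ℂ)) * (1 + Complex.I • toC B).det).im = 0 ∧
          ∀ j, 1 ≤ j → j ≤ p →
            esymm j (toC A * (1 + Complex.I • toC B)⁻¹)
              = (-1 : ℂ) ^ j * esymm j (toC A * (1 - Complex.I • toC B)⁻¹)) := by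
  obtain ⟨hC, hD⟩ := unit_det B hB
  have hc : Complex.exp (-(Complex.I * (θ : ℂ))) * Complex.I ^ q
      = Complex.exp (Complex.I * (φ : ℂ)) := by
    have : Complex.I ^ q = Complex.exp (q * (Real.pi / 2 * Complex.I)) := by
      rw [Complex.exp_nat_mul, Complex.exp_pi_div_two_mul_I]
    rw [this, ← Complex.exp_add, hφ]
    congr 1
    push_cast
    ring
  rw [hc]
  have hc0 : Complex.exp (Complex.I * (φ : ℂ)) ≠ 0 := Complex.exp_ne_zero _
  generalize Complex.exp (Complex.I * (φ : ℂ)) = c at hc0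
  set P := sgP (toC A * (1 + Complex.I • toC B)⁻¹) with hP
  set Q := sgP (toC A * (1 - Complex.I • toC B)⁻¹) with hQ
  have h1 (s : ℝ) : (1 + Complex.I • ((s : ℂ) • toC A + toC B)).det
      = P.eval (Complex.I * s) * (1 + Complex.I • toC B).det := by
    rw [hP, ← sgP_det _ _ hC.isUnit]
    congr 1
    rw [smul_add, smul_smul]; abel
  have h2 (s : ℝ) : (starRingEnd ℂ) (1 + Complex.I • ((s : ℂ) • toC A + toC B)).det
      = (Q.comp (-X)).eval (Complex.I * s) * (1 - Complex.I • toC B).det := by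
    have e : (s : ℂ) • toC A + toC B = toC (s • A + B) := by
      ext i j; simp [toC]
    rw [e, conj_det, ← e, eval_comp, hQ, ← sgP_det _ _ hD.isUnit]
    congr 1
    simp only [eval_neg, eval_X]
    rw [smul_add, smul_smul, neg_smul]; abel
  have h3 := conj_det B
  have hP0 : P.eval 0 = 1 := by simp [hP, sgP_eval]
  have hQ0 : Q.eval 0 = 1 := by simp [hQ, sgP_eval]
  have hcoef (j : ℕ) : (Q.comp (-X)).coeff j = (-1) ^ j * Q.coeff j := by
    have e : (-X : ℂ[X]) = Polynomial.C (-1) * X := by simp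
    rw [e, Polynomial.comp_C_mul_X_coeff, mul_comm]
  have key : (∀ j, 1 ≤ j → j ≤ p →
            esymm j (toC A * (1 + Complex.I • toC B)⁻¹)
              = (-1 : ℂ) ^ j * esymm j (toC A * (1 - Complex.I • toC B)⁻¹))
      ↔ P = Q.comp (-X) := by
    constructor
    · intro h
      ext j
      rw [hcoef]
      rcases Nat.eq_zero_or_pos j with rfl | hj
      · rw [coeff_zero_eq_eval_zero, coeff_zero_eq_eval_zero, hP0, hQ0]; simp
      · by_cases hjp : j ≤ p
        · exact h j hj hjp
        · rw [coeff_eq_zero_of_natDegree_lt (lt_of_le_of_lt (sgP_deg _) (not_le.mp hjp)),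
            coeff_eq_zero_of_natDegree_lt (lt_of_le_of_lt (sgP_deg _) (not_le.mp hjp)), mul_zero]
    · intro h j _ _
      have := hcoef j
      rw [← h] at this
      exact this
  rw [key]
  simp only [← Complex.conj_eq_iff_im, map_mul, h2, h3] at *
  simp only [h1]
  constructor
  · intro h
    have h0 : (starRingEnd ℂ) c * (1 - Complex.I • toC B).det = c * (1 + Complex.I • toC B).det := by
      have := h 0
      simpa [eval_comp, hP0, hQ0] using this
    refine ⟨h0, ?_⟩
    apply Polynomial.eq_of_infinite_eval_eq
    have hinj : Function.Injective (fun s : ℝ => Complex.I * (s : ℂ)) := by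
      intro a b hab
      simpa using hab
    refine (Set.infinite_range_of_injective hinj).mono ?_
    rintro _ ⟨s, rfl⟩
    have hs := h s
    apply mul_right_cancel₀ (mul_ne_zero hc0 hC)
    show eval (Complex.I * s) P * _ = eval (Complex.I * s) (Q.comp (-X)) * _
    linear_combination -hs + (Q.comp (-X)).eval (Complex.I * s) * h0
  · rintro ⟨h0, h⟩ s
    rw [← h]
    linear_combination P.eval (Complex.I * s) * h0
end

section
/- Let p ≥ 1, let A be a p×p real symmetric matrix regarded as a complex matrix, and let φ ∈ ℝ. Then Im( e^{iφ} · det(I + i·s·A) ) = 0 for all s ∈ ℝ if and only if sin(φ) = 0 and σ_j(A) = 0 for every odd j with 1 ≤ j ≤ p. -/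
open Matrix Polynomial

lemma det_aux {p : ℕ} (A : Matrix (Fin p) (Fin p) ℝ) (z : ℂ) :
    (1 + z • toC A).det = aeval z ((1 + (X : ℝ[X]) • A.map Polynomial.C).det) := by
  rw [AlgHom.map_det]
  congr 1
  ext i j
  by_cases h : i = j
  · subst h; simp [toC]; ring
  · simp [toC, Matrix.one_apply_ne h]; ring

lemma odd_aux (P : ℝ[X]) :
    (∀ s : ℝ, (aeval (Complex.I * (s : ℂ)) P).im = 0) ↔ ∀ j, Odd j → P.coeff j = 0 := by
  have key : ∀ s : ℝ, (aeval (Complex.I * (s : ℂ)) P).im = 0 ↔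
      aeval (Complex.I * (s : ℂ)) (P.comp (-X)) = aeval (Complex.I * (s : ℂ)) P := by
    intro s
    rw [← Complex.conj_eq_iff_im, ← Polynomial.aeval_conj, aeval_comp]
    simp
  simp only [key]
  have h2 : (∀ j, Odd j → P.coeff j = 0) ↔ P.comp (-X) = P := by
    rw [Polynomial.ext_iff]
    refine forall_congr' fun j => ?_
    rw [show (-X : ℝ[X]) = C (-1) * X by simp, comp_C_mul_X_coeff, mul_comm]
    rcases Nat.even_or_odd j with h | h
    · simp [h.neg_one_pow, h]
    · simp only [h, h.neg_one_pow, true_imp_iff]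
      constructor <;> intro h <;> linarith
  rw [h2]
  refine ⟨fun h => ?_, fun h s => by rw [h]⟩
  have : ((P.comp (-X) - P).map (algebraMap ℝ ℂ)) = 0 := by
    apply eq_zero_of_infinite_isRoot
    refine (Set.infinite_range_of_injective (f := fun s : ℝ => Complex.I * (s : ℂ)) ?_).mono ?_
    · intro a b hab
      simpa using hab
    · rintro _ ⟨s, rfl⟩
      have := h s
      simp only [Set.mem_ofPred_eq, IsRoot.def, eval_map_algebraMap]
      rw [map_sub, this, sub_self]
  rw [Polynomial.map_eq_zero] at this
  exact sub_eq_zero.mp this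

theorem stmt9 {p : ℕ} (hp : 1 ≤ p) (A : Matrix (Fin p) (Fin p) ℝ) (hA : A.IsSymm) (φ : ℝ) :
    (∀ s : ℝ,
        (Complex.exp (Complex.I * (φ : ℂ)) *
          (1 + (Complex.I * (s : ℂ)) • toC A).det).im = 0)
      ↔ (Real.sin φ = 0 ∧ ∀ j, Odd j → 1 ≤ j → j ≤ p → esymm j A = 0) := by
  have him : (Complex.exp (Complex.I * (φ : ℂ))).im = Real.sin φ := by
    rw [mul_comm, Complex.exp_ofReal_mul_I_im]
  have hre : (Complex.exp (Complex.I * (φ : ℂ))).re = Real.cos φ := by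
    rw [mul_comm, Complex.exp_ofReal_mul_I_re]
  have hs : (∀ s : ℝ, (Complex.exp (Complex.I * (φ : ℂ)) *
          (1 + (Complex.I * (s : ℂ)) • toC A).det).im = 0) → Real.sin φ = 0 := by
    intro h
    have := h 0
    simpa [him] using this
  have hdeg : ((1 + (X : ℝ[X]) • A.map Polynomial.C).det).natDegree ≤ p := by
    have := natDegree_det_X_add_C_le A 1
    simpa [add_comm] using this
  have hmain : Real.sin φ = 0 → ((∀ s : ℝ, (Complex.exp (Complex.I * (φ : ℂ)) *
          (1 + (Complex.I * (s : ℂ)) • toC A).det).im = 0) ↔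
          ∀ j, Odd j → 1 ≤ j → j ≤ p → esymm j A = 0) := by
    intro h0
    have hc : Real.cos φ ≠ 0 := by
      intro hc
      have := Real.sin_sq_add_cos_sq φ
      simp [h0, hc] at this
    simp only [Complex.mul_im, him, hre, h0, zero_mul, add_zero, mul_eq_zero, hc, false_or, det_aux]
    rw [odd_aux]
    refine forall_congr' fun j => forall_congr' fun hj => ⟨fun h _ _ => h, fun h => ?_⟩
    by_cases hjp : j ≤ p
    · exact h hj.pos hjp
    · exact coeff_eq_zero_of_natDegree_lt (by omega)
  exact ⟨fun h => ⟨hs h, (hmain (hs h)).1 h⟩, fun h => (hmain h.1).2 h.2⟩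
end

section
/- Let A and B be 2×2 real symmetric matrices regarded as complex matrices, with det(A) ≠ 0, and let φ ∈ ℝ. Then Im( e^{iφ} · det(I + i·(s·A + B)) ) = 0 for all s ∈ ℝ if and only if sin(φ) = 0, Tr(B) = 0, and Tr(A) = 0. -/
open Matrix Polynomial

theorem stmt11 (A B : Matrix (Fin 2) (Fin 2) ℝ) (hA : A.IsSymm) (hB : B.IsSymm)
    (hdet : A.det ≠ 0) (φ : ℝ) :
    (∀ s : ℝ,
        (Complex.exp (Complex.I * (φ : ℂ)) *
          (1 + Complex.I • ((s : ℂ) • toC A + toC B)).det).im = 0)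
      ↔ (Real.sin φ = 0 ∧ B.trace = 0 ∧ A.trace = 0) := by
  have key : ∀ s : ℝ, (Complex.exp (Complex.I * (φ : ℂ)) *
          (1 + Complex.I • ((s : ℂ) • toC A + toC B)).det).im
      = Real.cos φ * (s * A.trace + B.trace) + Real.sin φ * (1 - (s • A + B).det) := by
    intro s
    rw [mul_comm Complex.I, Complex.exp_mul_I, ← Complex.ofReal_cos, ← Complex.ofReal_sin]
    simp [Matrix.det_fin_two, Matrix.trace_fin_two, toC, -Complex.ofReal_cos, -Complex.ofReal_sin]
    ring
  simp only [key]
  rw [Matrix.det_fin_two] at hdet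
  simp only [Matrix.det_fin_two, Matrix.add_apply, Matrix.smul_apply, smul_eq_mul]
  constructor
  · intro h
    have h0 := h 0
    have h1 := h 1
    have h2 := h (-1)
    have h3 := h 2
    have hs : Real.sin φ = 0 := by
      have : Real.sin φ * (A 0 0 * A 1 1 - A 0 1 * A 1 0) = 0 := by
        linear_combination h0 - h1 / 2 - h2 / 2
      exact (mul_eq_zero.mp this).resolve_right hdet
    have hc : Real.cos φ ≠ 0 := by
      intro hc
      have := Real.sin_sq_add_cos_sq φ
      rw [hs, hc] at this
      norm_num at this
    rw [hs] at h0 h1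
    have hb : B.trace = 0 := by simpa [hc] using h0
    refine ⟨hs, hb, ?_⟩
    simpa [hc, hb] using h1
  · rintro ⟨hs, hb, ha⟩ s
    rw [hs, hb, ha]
    ring
end
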